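/- arXiv:2503.00328 — 3 statements merged into one kernel-verified Lean document; each statement's English description precedes it below -/
import Mathlib

section
/- Let P be a polynomial with complex coefficients of degree n having no zeros in the open unit disk {z : |z| < 1}, let a be a complex number with |a| ≤ 1, and let β be a complex number with |β| ≤ 1. Then for every real R ≥ 1 and every complex z with |z| ≥ 1, |S̃_a[P](Rz) + β·((R+1)/2)^n·S̃_a[P](z)| ≤ (1/2)·[ |R^n + β·((R+1)/2)^n| · n|z|^(n−1) + |1 + β·((R+1)/2)^n| · n|a| ] · max_{|w|=1} |P(w)|. -/
open Polynomial

/-- The modified Smirnov operator: S̃ₐ[P](z) = (1+az)·P′(z) − n·a·P(z). -/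
noncomputable def smirnov (n : ℕ) (a : ℂ) (P : Polynomial ℂ) (z : ℂ) : ℂ :=
  (1 + a * z) * P.derivative.eval z - (n : ℂ) * a * P.eval z

/-- The maximum of ‖P‖ on the unit circle. -/
noncomputable def maxCircle (P : Polynomial ℂ) : ℝ :=
  sSup {y : ℝ | ∃ w : ℂ, ‖w‖ = 1 ∧ y = ‖P.eval w‖}

open scoped ComplexConjugate

/-- The conjugate reciprocal `z ^ n * conj (P (1 / conj z))` of a polynomial of degree at most `n`. -/
noncomputable def conjReflect (n : ℕ) (P : ℂ[X]) : ℂ[X] :=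
  reflect n (P.map (starRingEnd ℂ))

theorem eval_conjReflect {n : ℕ} {P : ℂ[X]} (hP : P.natDegree ≤ n) {w : ℂ} (hw : w ≠ 0) :
    (conjReflect n P).eval w = w ^ n * conj (P.eval (conj w)⁻¹) := by
  let := invertibleOfNonzero (inv_ne_zero hw)
  have h := eval₂_reflect_mul_pow (RingHom.id ℂ) w⁻¹ n (P.map (starRingEnd ℂ))
    (natDegree_map_le.trans hP)
  rw [invOf_eq_inv, inv_inv, ← eval, ← eval] at h
  have h2 : (P.map (starRingEnd ℂ)).eval w⁻¹ = conj (P.eval (conj w)⁻¹) := by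
    have := eval_map_apply (p := P) (f := starRingEnd ℂ) (conj w)⁻¹
    simpa using this
  rw [← h2, ← h, conjReflect, mul_comm, mul_assoc, ← mul_pow, inv_mul_cancel₀ hw, one_pow, mul_one]

theorem norm_eval_eq_prod_roots (P : ℂ[X]) (w : ℂ) :
    ‖P.eval w‖ = ‖P.leadingCoeff‖ * (P.roots.map fun ζ => ‖w - ζ‖).prod := by
  rw [(IsAlgClosed.splits P).eval_eq_prod_roots, norm_mul]
  congr 1
  simpa using map_multiset_prod (normHom : ℂ →*₀ ℝ) (P.roots.map fun ζ => w - ζ)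

theorem norm_sub_le_mul_norm_inv_conj_sub {w ζ : ℂ} (hw : 1 ≤ ‖w‖) (hζ : 1 ≤ ‖ζ‖) :
    ‖w - ζ‖ ≤ ‖w‖ * ‖(conj w)⁻¹ - ζ‖ := by
  have hw0 : conj w ≠ 0 := by
    rw [Ne, map_eq_zero]; rintro rfl; norm_num at hw
  have h1 : ‖w‖ * ‖(conj w)⁻¹ - ζ‖ = ‖1 - conj w * ζ‖ := by
    rw [← Complex.norm_conj w, ← norm_mul, mul_sub, mul_inv_cancel₀ hw0]
  rw [h1]
  refine le_of_sq_le_sq ?_ (norm_nonneg _)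
  have hw2 : 1 ≤ ‖w‖ ^ 2 := one_le_pow₀ hw
  have hζ2 : 1 ≤ ‖ζ‖ ^ 2 := one_le_pow₀ hζ
  simp only [Complex.sq_norm, Complex.normSq_apply] at *
  simp only [Complex.sub_re, Complex.sub_im, Complex.mul_re, Complex.mul_im, Complex.one_re,
    Complex.one_im, Complex.conj_re, Complex.conj_im]
  nlinarith [mul_nonneg (sub_nonneg.2 hw2) (sub_nonneg.2 hζ2)]

theorem norm_eval_le_norm_eval_conjReflect {n : ℕ} {P : ℂ[X]} (hP : P.natDegree = n)
    (hP0 : ∀ w : ℂ, ‖w‖ < 1 → P.eval w ≠ 0) {w : ℂ} (hw : 1 ≤ ‖w‖) :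
    ‖P.eval w‖ ≤ ‖(conjReflect n P).eval w‖ := by
  have hw0 : w ≠ 0 := by rintro rfl; norm_num at hw
  rw [eval_conjReflect hP.le hw0, norm_mul, norm_pow, Complex.norm_conj,
    norm_eval_eq_prod_roots, norm_eval_eq_prod_roots]
  have hc : n = Multiset.card P.roots := by
    rw [← hP, (IsAlgClosed.splits P).natDegree_eq_card_roots]
  have h2 : ‖w‖ ^ n * (P.roots.map fun ζ => ‖(conj w)⁻¹ - ζ‖).prod
      = (P.roots.map fun ζ => ‖w‖ * ‖(conj w)⁻¹ - ζ‖).prod := by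
    rw [Multiset.prod_map_mul, Multiset.map_const', Multiset.prod_replicate, ← hc]
  rw [mul_left_comm, h2]
  gcongr
  refine Multiset.prod_map_le_prod_map₀ _ _ (fun _ _ => norm_nonneg _) fun ζ hζ => ?_
  refine norm_sub_le_mul_norm_inv_conj_sub hw (not_lt.1 fun h => hP0 ζ h ?_)
  exact (mem_roots'.1 hζ).2

theorem coeff_conjReflect_self (n : ℕ) (P : ℂ[X]) :
    (conjReflect n P).coeff n = conj (P.eval 0) := by
  rw [conjReflect, coeff_reflect, revAt_le le_rfl, Nat.sub_self, coeff_map, coeff_zero_eq_eval_zero]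

theorem natDegree_conjReflect_le {n : ℕ} {P : ℂ[X]} (hP : P.natDegree ≤ n) :
    (conjReflect n P).natDegree ≤ n := by
  rw [natDegree_le_iff_coeff_eq_zero]
  intro N hN
  rw [conjReflect, coeff_reflect, revAt_eq_self_of_lt hN, coeff_map,
    coeff_eq_zero_of_natDegree_lt (hP.trans_lt hN), map_zero]

theorem norm_leadingCoeff_le_norm_eval_zero {P : ℂ[X]}
    (hP0 : ∀ w : ℂ, ‖w‖ < 1 → P.eval w ≠ 0) : ‖P.leadingCoeff‖ ≤ ‖P.eval 0‖ := by
  rw [norm_eval_eq_prod_roots]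
  refine le_mul_of_one_le_right (norm_nonneg _) ?_
  refine Multiset.one_le_prod fun x hx => ?_
  obtain ⟨ζ, hζ, rfl⟩ := Multiset.mem_map.1 hx
  rw [zero_sub, norm_neg]
  exact not_lt.1 fun h => hP0 ζ h (mem_roots'.1 hζ).2

/-- A linear functional that vanishes on no polynomial of degree `n` with all its zeros in the
closed unit disk. -/
def NonvanishingOnDisk (n : ℕ) (L : ℂ[X] →ₗ[ℂ] ℂ) : Prop :=
  ∀ F : ℂ[X], F.natDegree = n → F ≠ 0 → (∀ w : ℂ, 1 < ‖w‖ → F.eval w ≠ 0) → L F ≠ 0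

theorem eval_conjReflect_ne_zero {n : ℕ} {P : ℂ[X]} (hP : P.natDegree ≤ n)
    (hP0 : ∀ w : ℂ, ‖w‖ < 1 → P.eval w ≠ 0) {w : ℂ} (hw : 1 < ‖w‖) :
    (conjReflect n P).eval w ≠ 0 := by
  have hw0 : w ≠ 0 := by rintro rfl; norm_num at hw
  rw [eval_conjReflect hP hw0]
  refine mul_ne_zero (pow_ne_zero _ hw0) ?_
  rw [Ne, map_eq_zero]
  refine hP0 _ ?_
  rw [norm_inv, Complex.norm_conj]
  exact inv_lt_one_of_one_lt₀ hw

theorem NonvanishingOnDisk.norm_le_norm_conjReflect {n : ℕ} {L : ℂ[X] →ₗ[ℂ] ℂ}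
    (hL : NonvanishingOnDisk n L) {P : ℂ[X]} (hP : P.natDegree = n)
    (hP0 : ∀ w : ℂ, ‖w‖ < 1 → P.eval w ≠ 0) : ‖L P‖ ≤ ‖L (conjReflect n P)‖ := by
  by_contra! h
  have hLP : L P ≠ 0 := norm_pos_iff.1 ((norm_nonneg _).trans_lt h)
  set Q := conjReflect n P with hQ
  set c := L Q / L P with hc
  have hc1 : ‖c‖ < 1 := by rwa [hc, norm_div, div_lt_one (norm_pos_iff.2 hLP)]
  have key : ∀ x y : ℂ, ‖x‖ ≤ ‖y‖ → y ≠ 0 → y - c * x ≠ 0 := by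
    intro x y hxy hy h0
    have : ‖y‖ = ‖c‖ * ‖x‖ := by rw [sub_eq_zero.1 h0, norm_mul]
    have hy' := norm_pos_iff.2 hy
    nlinarith [norm_nonneg x, norm_nonneg c]
  have hcoeff : (Q - C c * P).coeff n ≠ 0 := by
    rw [coeff_sub, coeff_C_mul, hQ, coeff_conjReflect_self]
    refine key _ _ ?_ ?_
    · rw [Complex.norm_conj, ← hP]
      exact norm_leadingCoeff_le_norm_eval_zero hP0
    · rw [Ne, map_eq_zero]
      exact hP0 0 (by simp)
  refine hL (Q - C c * P) ?_ ?_ (fun w hw => ?_) ?_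
  · refine natDegree_eq_of_le_of_coeff_ne_zero ?_ hcoeff
    exact (natDegree_sub_le_of_le (natDegree_conjReflect_le hP.le)
      ((natDegree_C_mul_le _ _).trans hP.le)).trans_eq (max_self n)
  · rintro h0
    simp [h0] at hcoeff
  · rw [eval_sub, eval_mul, eval_C]
    exact key _ _ (norm_eval_le_norm_eval_conjReflect hP hP0 hw.le)
      (eval_conjReflect_ne_zero hP.le hP0 hw)
  · rw [map_sub, ← smul_eq_C_mul, map_smul, smul_eq_mul, hc, div_mul_cancel₀ _ hLP, sub_self]

theorem norm_eval_le_maxCircle (P : ℂ[X]) {w : ℂ} (hw : ‖w‖ ≤ 1) : ‖P.eval w‖ ≤ maxCircle P := by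
  have hbdd : BddAbove {y : ℝ | ∃ w : ℂ, ‖w‖ = 1 ∧ y = ‖P.eval w‖} := by
    have := ((isCompact_sphere (0 : ℂ) 1).image (P.continuous.norm)).bddAbove
    refine this.mono ?_
    rintro y ⟨w, hw, rfl⟩
    exact ⟨w, by simpa using hw, rfl⟩
  refine Complex.norm_le_of_forall_mem_frontier_norm_le (U := Metric.ball 0 1)
    Metric.isBounded_ball P.differentiable.diffContOnCl (fun z hz => ?_) ?_
  · rw [frontier_ball _ one_ne_zero] at hz
    exact le_csSup hbdd ⟨z, by simpa using hz, rfl⟩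
  · rw [closure_ball _ one_ne_zero]
    simpa using hw

theorem NonvanishingOnDisk.norm_add_norm_conjReflect_le {n : ℕ} {L : ℂ[X] →ₗ[ℂ] ℂ}
    (hL : NonvanishingOnDisk n L) {P : ℂ[X]} (hP : P.natDegree = n) :
    ‖L P‖ + ‖L (conjReflect n P)‖ ≤ (‖L (X ^ n)‖ + ‖L 1‖) * maxCircle P := by
  set Q := conjReflect n P with hQ
  have hM : 0 ≤ maxCircle P :=
    (norm_nonneg _).trans (norm_eval_le_maxCircle P (w := 0) (by simp))
  have hX : L (X ^ n) ≠ 0 := by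
    refine hL _ (by simp) (by simp) fun w hw => ?_
    rw [eval_pow, eval_X]
    refine pow_ne_zero _ ?_
    rintro rfl
    norm_num at hw
  have hX' := norm_pos_iff.2 hX
  have hdeg (c : ℂ) : (P - C c).natDegree = n := by rw [natDegree_sub_C, hP]
  have hzero {c : ℂ} (hc : maxCircle P < ‖c‖) : ∀ w : ℂ, ‖w‖ < 1 → (P - C c).eval w ≠ 0 := by
    intro w hw h0
    rw [eval_sub, eval_C, sub_eq_zero] at h0
    exact (norm_eval_le_maxCircle P hw.le).not_gt (h0 ▸ hc)
  have hrefl (c : ℂ) : conjReflect n (P - C c) = Q - C (conj c) * X ^ n := by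
    rw [hQ, conjReflect, conjReflect, Polynomial.map_sub, map_C, reflect_sub, reflect_C]
  have hLrefl (c : ℂ) : L (conjReflect n (P - C c)) = L Q - conj c * L (X ^ n) := by
    rw [hrefl, map_sub, ← smul_eq_C_mul, map_smul, smul_eq_mul]
  have hLQ : ‖L Q‖ ≤ maxCircle P * ‖L (X ^ n)‖ := by
    by_contra! h
    set c := conj (L Q / L (X ^ n)) with hc
    have hcM : maxCircle P < ‖c‖ := by
      rwa [hc, Complex.norm_conj, norm_div, lt_div_iff₀ hX']
    have h0 : (P - C c).eval 0 ≠ 0 := hzero hcM 0 (by simp)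
    have hcoeff : (conjReflect n (P - C c)).coeff n ≠ 0 := by
      rwa [coeff_conjReflect_self, Ne, map_eq_zero]
    refine hL (conjReflect n (P - C c)) ?_ ?_
      (fun w hw => eval_conjReflect_ne_zero (hdeg c).le (hzero hcM) hw) ?_
    · exact natDegree_eq_of_le_of_coeff_ne_zero (natDegree_conjReflect_le (hdeg c).le) hcoeff
    · intro h0
      simp [h0] at hcoeff
    · rw [hLrefl, hc, Complex.conj_conj, div_mul_cancel₀ _ hX, sub_self]
  have main : ∀ r, maxCircle P < r → ‖L P‖ + ‖L Q‖ ≤ (‖L (X ^ n)‖ + ‖L 1‖) * r := by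
    intro r hr
    have hr0 := hM.trans_lt hr
    obtain ⟨u, hu, huQ⟩ : ∃ u : ℂ, ‖u‖ = 1 ∧ L Q = u * ‖L Q‖ := by
      by_cases h0 : L Q = 0
      · exact ⟨1, by simp, by simp [h0]⟩
      · have h0' : (‖L Q‖ : ℂ) ≠ 0 := by simpa using h0
        exact ⟨L Q / ‖L Q‖, by simp [h0], by field_simp⟩
    set c := conj (u * (r * ‖L (X ^ n)‖ : ℝ) / L (X ^ n)) with hc
    have hcr : ‖c‖ = r := by
      rw [hc, Complex.norm_conj, norm_div, norm_mul, hu, Complex.norm_real, Real.norm_eq_abs,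
        abs_of_pos (mul_pos hr0 hX')]
      field_simp
    have h1 := hL.norm_le_norm_conjReflect (hdeg c) (hzero (hr.trans_eq hcr.symm))
    have h2 : L (conjReflect n (P - C c)) = u * ((‖L Q‖ - r * ‖L (X ^ n)‖ : ℝ) : ℂ) := by
      rw [hLrefl, hc, Complex.conj_conj, div_mul_cancel₀ _ hX]
      nth_rw 1 [huQ]
      push_cast
      ring
    have h3 : ‖L Q‖ - r * ‖L (X ^ n)‖ ≤ 0 := by
      have := mul_le_mul_of_nonneg_right hr.le hX'.le
      linarith
    rw [h2, norm_mul, hu, one_mul, Complex.norm_real, Real.norm_eq_abs, abs_of_nonpos h3,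
      ← mul_one (C c), ← smul_eq_C_mul, map_sub, map_smul, smul_eq_mul] at h1
    have h4 := norm_sub_norm_le (L P) (c * L 1)
    rw [norm_mul, hcr] at h4
    linarith
  have hcont : Filter.Tendsto (fun r => (‖L (X ^ n)‖ + ‖L 1‖) * r)
      (nhdsWithin (maxCircle P) (Set.Ioi (maxCircle P)))
      (nhds ((‖L (X ^ n)‖ + ‖L 1‖) * maxCircle P)) :=
    (Continuous.tendsto (by fun_prop) _).mono_left nhdsWithin_le_nhds
  exact ge_of_tendsto hcont (Filter.eventually_of_mem self_mem_nhdsWithin main)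

theorem NonvanishingOnDisk.two_mul_norm_le {n : ℕ} {L : ℂ[X] →ₗ[ℂ] ℂ}
    (hL : NonvanishingOnDisk n L) {P : ℂ[X]} (hP : P.natDegree = n)
    (hP0 : ∀ w : ℂ, ‖w‖ < 1 → P.eval w ≠ 0) :
    2 * ‖L P‖ ≤ (‖L (X ^ n)‖ + ‖L 1‖) * maxCircle P := by
  have h1 := hL.norm_le_norm_conjReflect hP hP0
  have h2 := hL.norm_add_norm_conjReflect_le hP
  linarith

theorem re_mobius_mul_pos {a z ζ : ℂ} (ha : ‖a‖ < 1) (hz : 1 < ‖z‖) (hζ : ‖ζ‖ ≤ 1) :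
    0 < ((1 + a * ζ) / (z - ζ) * (z + conj a)).re := by
  set N := 1 + a * ζ with hN
  set D := z - ζ with hD
  have hD0 : D ≠ 0 := by
    rw [hD, sub_ne_zero]
    rintro rfl
    exact hζ.not_gt hz
  have hD2 : 0 < Complex.normSq D := Complex.normSq_pos.2 hD0
  have h1 : Complex.normSq (N * z - D) ≤ Complex.normSq (N + a * D) := by
    have e1 : N * z - D = ζ * (N + a * D) := by rw [hN, hD]; ring
    rw [e1, Complex.normSq_mul]
    refine mul_le_of_le_one_left (Complex.normSq_nonneg _) ?_
    rw [Complex.normSq_eq_norm_sq]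
    exact pow_le_one₀ (norm_nonneg _) hζ
  rw [Complex.normSq_sub, Complex.normSq_add, Complex.normSq_mul, Complex.normSq_mul] at h1
  have ha2 : Complex.normSq a < 1 := by
    rw [Complex.normSq_eq_norm_sq]
    exact pow_lt_one₀ (norm_nonneg _) ha two_ne_zero
  have hz2 : 1 ≤ Complex.normSq z := by
    rw [Complex.normSq_eq_norm_sq]
    exact one_le_pow₀ hz.le
  have e2 : (N / D * (z + conj a)).re
      = ((N * z * conj D).re + (N * conj (a * D)).re) / Complex.normSq D := by
    rw [← Complex.add_re, ← Complex.div_ofReal_re]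
    congr 1
    rw [Complex.normSq_eq_conj_mul_self, map_mul]
    have hD0' : conj D ≠ 0 := by rwa [Ne, map_eq_zero]
    field_simp
  rw [e2]
  refine div_pos ?_ hD2
  nlinarith [mul_nonneg (Complex.normSq_nonneg N) (sub_nonneg.2 hz2),
    mul_pos hD2 (sub_pos.2 ha2)]

theorem re_sum_mobius_mul_pos {a z : ℂ} (ha : ‖a‖ < 1) (hz : 1 < ‖z‖) {s : Multiset ℂ}
    (hs : ∀ ζ ∈ s, ‖ζ‖ ≤ 1) (hs0 : s ≠ 0) :
    0 < ((s.map fun ζ => (1 + a * ζ) / (z - ζ)).sum * (z + conj a)).re := by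
  rw [← Multiset.sum_map_mul_right, ← Complex.coe_reAddGroupHom, map_multiset_sum, Multiset.map_map]
  have h := Multiset.sum_lt_sum_of_nonempty (f := fun _ => (0 : ℝ)) hs0
    fun ζ hζ => re_mobius_mul_pos ha hz (hs ζ hζ)
  simpa [Function.comp_def] using h

/-- The modified Smirnov operator with values in polynomials. -/
noncomputable def smirnovPoly (n : ℕ) (a : ℂ) (P : ℂ[X]) : ℂ[X] :=
  (1 + C a * X) * derivative P - C (n * a) * P

theorem eval_smirnovPoly (n : ℕ) (a : ℂ) (P : ℂ[X]) (z : ℂ) :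
    (smirnovPoly n a P).eval z = smirnov n a P z := by
  simp [smirnovPoly, smirnov]

theorem coeff_smirnovPoly (n : ℕ) (a : ℂ) (P : ℂ[X]) (i : ℕ) :
    (smirnovPoly n a P).coeff i = (i + 1) * P.coeff (i + 1) + a * (i - n) * P.coeff i := by
  rw [smirnovPoly, add_mul, one_mul, coeff_sub, coeff_add, mul_assoc, coeff_C_mul, coeff_C_mul,
    coeff_derivative]
  cases i with
  | zero => simp; ring
  | succ i =>
    rw [coeff_X_mul, coeff_derivative]
    push_cast
    ring

theorem norm_le_one_of_mem_roots {F : ℂ[X]} (hF : ∀ w : ℂ, 1 < ‖w‖ → F.eval w ≠ 0) {ζ : ℂ}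
    (hζ : ζ ∈ F.roots) : ‖ζ‖ ≤ 1 :=
  not_lt.1 fun h => hF ζ h (mem_roots'.1 hζ).2

theorem natDegree_smirnovPoly {m : ℕ} {a : ℂ} (ha : ‖a‖ < 1) {F : ℂ[X]}
    (hF : F.natDegree = m + 1) (hF0 : ∀ w : ℂ, 1 < ‖w‖ → F.eval w ≠ 0) :
    (smirnovPoly (m + 1) a F).natDegree = m := by
  refine natDegree_eq_of_le_of_coeff_ne_zero ?_ ?_
  · rw [natDegree_le_iff_coeff_eq_zero]
    intro N hN
    rw [coeff_smirnovPoly, coeff_eq_zero_of_natDegree_lt (by omega : F.natDegree < N + 1)]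
    obtain rfl | h := (Nat.succ_le_of_lt hN).eq_or_lt
    · simp
    · rw [coeff_eq_zero_of_natDegree_lt (by omega : F.natDegree < N)]
      simp
  · have hs := IsAlgClosed.splits F
    have h1 : F.coeff m = -F.leadingCoeff * F.roots.sum := by
      rw [← hs.nextCoeff_eq_neg_sum_roots_mul_leadingCoeff,
        nextCoeff_of_natDegree_pos (by omega), hF, Nat.add_sub_cancel]
    have h2 : F.coeff (m + 1) = F.leadingCoeff := by rw [leadingCoeff, hF]
    have h3 : F.leadingCoeff ≠ 0 := by
      rw [leadingCoeff_ne_zero]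
      rintro rfl
      simp at hF
    have h4 : ‖F.roots.sum‖ ≤ m + 1 := by
      refine (norm_multiset_sum_le _).trans ?_
      refine (Multiset.sum_le_card_nsmul _ 1 fun x hx => ?_).trans_eq ?_
      · obtain ⟨ζ, hζ, rfl⟩ := Multiset.mem_map.1 hx
        exact norm_le_one_of_mem_roots hF0 hζ
      · rw [Multiset.card_map, ← hs.natDegree_eq_card_roots, hF]
        simp
    have h5 : (smirnovPoly (m + 1) a F).coeff m
        = F.leadingCoeff * ((m + 1 : ℝ) + a * F.roots.sum : ℂ) := by
      rw [coeff_smirnovPoly, h1, h2]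
      push_cast
      ring
    rw [h5]
    refine mul_ne_zero h3 fun h0 => ?_
    have h6 : ‖((m + 1 : ℝ) : ℂ)‖ = ‖a‖ * ‖F.roots.sum‖ := by
      rw [← norm_mul, ← norm_neg (a * _), ← eq_neg_of_add_eq_zero_left h0]
    rw [Complex.norm_real, Real.norm_eq_abs, abs_of_pos (by positivity)] at h6
    nlinarith [norm_nonneg F.roots.sum, norm_nonneg a]

theorem smirnov_eq_eval_mul_sum {n : ℕ} (a : ℂ) {F : ℂ[X]} (hF : F.natDegree = n) {z : ℂ}
    (hz : F.eval z ≠ 0) :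
    smirnov n a F z = F.eval z * (F.roots.map fun ζ => (1 + a * ζ) / (z - ζ)).sum := by
  have hs := IsAlgClosed.splits F
  have hterm : (F.roots.map fun ζ => (1 + a * ζ) / (z - ζ))
      = F.roots.map fun ζ => (1 + a * z) * (1 / (z - ζ)) - a := by
    refine Multiset.map_congr rfl fun ζ hζ => ?_
    have : z - ζ ≠ 0 := by
      rw [sub_ne_zero]
      rintro rfl
      exact hz (mem_roots'.1 hζ).2
    field_simp
    ring
  rw [smirnov, hs.eval_derivative_eq_eval_mul_sum hz, hterm, Multiset.sum_map_sub,
    Multiset.sum_map_mul_left, Multiset.map_const', Multiset.sum_replicate,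
    ← hs.natDegree_eq_card_roots, hF, nsmul_eq_mul]
  ring

theorem smirnov_ne_zero {n : ℕ} (hn : n ≠ 0) {a : ℂ} (ha : ‖a‖ < 1) {F : ℂ[X]}
    (hF : F.natDegree = n) (hF0 : ∀ w : ℂ, 1 < ‖w‖ → F.eval w ≠ 0) {z : ℂ} (hz : 1 < ‖z‖) :
    smirnov n a F z ≠ 0 := by
  rw [smirnov_eq_eval_mul_sum a hF (hF0 z hz)]
  refine mul_ne_zero (hF0 z hz) fun h0 => ?_
  have hroots : F.roots ≠ 0 := by
    rw [← Multiset.card_pos, ← (IsAlgClosed.splits F).natDegree_eq_card_roots, hF]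
    exact Nat.pos_of_ne_zero hn
  have := re_sum_mobius_mul_pos ha hz (fun ζ hζ => norm_le_one_of_mem_roots hF0 hζ) hroots
  simp [h0] at this

theorem mul_norm_sub_le_norm_mul_sub {R : ℝ} (hR : 1 ≤ R) {z ζ : ℂ} (h : ‖ζ‖ ≤ ‖z‖) :
    (R + 1) / 2 * ‖z - ζ‖ ≤ ‖R * z - ζ‖ := by
  refine le_of_sq_le_sq ?_ (norm_nonneg _)
  have h2 : ‖ζ‖ ^ 2 ≤ ‖z‖ ^ 2 := by gcongr
  rw [mul_pow]
  simp only [Complex.sq_norm, Complex.normSq_apply] at *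
  simp only [Complex.sub_re, Complex.sub_im, Complex.mul_re, Complex.mul_im, Complex.ofReal_re,
    Complex.ofReal_im]
  nlinarith [mul_nonneg (sub_nonneg.2 hR) (sub_nonneg.2 h2), sq_nonneg ((R - 1) * (z.re + ζ.re)),
    sq_nonneg ((R - 1) * (z.im + ζ.im)),
    mul_nonneg (mul_nonneg (sub_nonneg.2 hR) (sub_nonneg.2 hR)) (sub_nonneg.2 h2)]

theorem pow_mul_norm_eval_le {G : ℂ[X]} (hG : ∀ w : ℂ, 1 < ‖w‖ → G.eval w ≠ 0) {R : ℝ}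
    (hR : 1 ≤ R) {z : ℂ} (hz : 1 ≤ ‖z‖) :
    ((R + 1) / 2) ^ G.natDegree * ‖G.eval z‖ ≤ ‖G.eval (R * z)‖ := by
  have h2 : ((R + 1) / 2) ^ G.natDegree * (G.roots.map fun ζ => ‖z - ζ‖).prod
      = (G.roots.map fun ζ => (R + 1) / 2 * ‖z - ζ‖).prod := by
    rw [Multiset.prod_map_mul, Multiset.map_const', Multiset.prod_replicate,
      (IsAlgClosed.splits G).natDegree_eq_card_roots]
  rw [norm_eval_eq_prod_roots, norm_eval_eq_prod_roots, mul_left_comm, h2]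
  gcongr
  refine Multiset.prod_map_le_prod_map₀ _ _ (fun _ _ => by positivity) fun ζ hζ => ?_
  exact mul_norm_sub_le_norm_mul_sub hR ((norm_le_one_of_mem_roots hG hζ).trans hz)

/-- The functional `P ↦ S̃ₐ[P](w) + μ S̃ₐ[P](z)`. -/
noncomputable def smirnovFunctional (n : ℕ) (a μ w z : ℂ) : ℂ[X] →ₗ[ℂ] ℂ where
  toFun P := smirnov n a P w + μ * smirnov n a P z
  map_add' P Q := by simp only [smirnov, derivative_add, eval_add]; ring
  map_smul' c P := by
    simp only [smirnov, derivative_smul, eval_smul, smul_eq_mul, RingHom.id_apply]; ring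

theorem smirnovFunctional_apply (n : ℕ) (a μ w z : ℂ) (P : ℂ[X]) :
    smirnovFunctional n a μ w z P = smirnov n a P w + μ * smirnov n a P z := rfl

theorem nonvanishingOnDisk_smirnovFunctional (m : ℕ) {a μ z : ℂ} {R : ℝ} (ha : ‖a‖ < 1)
    (hR : 1 ≤ R) (hμ : ‖μ‖ < ((R + 1) / 2) ^ m) (hz : 1 < ‖z‖) :
    NonvanishingOnDisk (m + 1) (smirnovFunctional (m + 1) a μ (R * z) z) := by
  intro F hF _ hF0 h0
  have hne (w : ℂ) (hw : 1 < ‖w‖) := smirnov_ne_zero m.succ_ne_zero ha hF hF0 hw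
  have h1 := pow_mul_norm_eval_le (G := smirnovPoly (m + 1) a F)
    (fun w hw => by rw [eval_smirnovPoly]; exact hne w hw) hR hz.le
  rw [natDegree_smirnovPoly ha hF hF0, eval_smirnovPoly, eval_smirnovPoly] at h1
  rw [smirnovFunctional_apply] at h0
  rw [eq_neg_of_add_eq_zero_left h0, norm_neg, norm_mul] at h1
  exact hμ.not_ge (le_of_mul_le_mul_right h1 (norm_pos_iff.2 (hne z hz)))

theorem smirnov_X_pow (n : ℕ) (a z : ℂ) : smirnov n a (X ^ n) z = n * z ^ (n - 1) := by
  cases n with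
  | zero => simp [smirnov]
  | succ n => simp [smirnov]; ring

theorem smirnov_one (n : ℕ) (a z : ℂ) : smirnov n a 1 z = -(n * a) := by
  simp [smirnov]

theorem two_mul_norm_smirnov_add_le {m : ℕ} {P : ℂ[X]} (hP : P.natDegree = m + 1)
    (hP0 : ∀ w : ℂ, ‖w‖ < 1 → P.eval w ≠ 0) {a μ : ℂ} (ha : ‖a‖ ≤ 1) {R : ℝ} (hR : 1 ≤ R)
    (hμ : ‖μ‖ ≤ ((R + 1) / 2) ^ m) {z : ℂ} (hz : 1 ≤ ‖z‖) :
    2 * ‖smirnov (m + 1) a P (R * z) + μ * smirnov (m + 1) a P z‖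
      ≤ (m + 1) * (‖z‖ ^ m * ‖R ^ m + μ‖ + ‖a‖ * ‖1 + μ‖) * maxCircle P := by
  have hstrict : ∀ t ∈ Set.Ioo (0 : ℝ) 1,
      2 * ‖smirnov (m + 1) (t * a) P (R * ((2 - t : ℝ) * z))
          + t * μ * smirnov (m + 1) (t * a) P ((2 - t : ℝ) * z)‖
        ≤ (m + 1) * (‖(2 - t : ℝ) * z‖ ^ m * ‖R ^ m + t * μ‖ + ‖t * a‖ * ‖1 + t * μ‖)
          * maxCircle P := by
    rintro t ⟨ht0, ht1⟩
    have hlt {x : ℂ} {r : ℝ} (hr : 0 < r) (hx : ‖x‖ ≤ r) : ‖t * x‖ < r := by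
      rw [norm_mul, Complex.norm_real, Real.norm_eq_abs, abs_of_pos ht0]
      nlinarith [norm_nonneg x]
    have hz' : 1 < ‖((2 - t : ℝ) : ℂ) * z‖ := by
      rw [norm_mul, Complex.norm_real, Real.norm_eq_abs, abs_of_pos (by linarith)]
      nlinarith
    have h := (nonvanishingOnDisk_smirnovFunctional m (hlt one_pos ha) hR
      (hlt (by positivity) hμ) hz').two_mul_norm_le hP hP0
    rw [smirnovFunctional_apply, smirnovFunctional_apply, smirnovFunctional_apply, smirnov_X_pow,
      smirnov_X_pow, smirnov_one, smirnov_one] at h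
    refine h.trans_eq ?_
    congr 1
    generalize ((2 - t : ℝ) : ℂ) * z = y
    have hm : ‖((m + 1 : ℕ) : ℂ)‖ = m + 1 := by
      rw [Complex.norm_natCast]; push_cast; rfl
    have e1 : ((m + 1 : ℕ) : ℂ) * (R * y) ^ (m + 1 - 1) + t * μ * (((m + 1 : ℕ) : ℂ) * y ^ (m + 1 - 1))
        = ((m + 1 : ℕ) : ℂ) * (y ^ m * (R ^ m + t * μ)) := by
      rw [Nat.add_sub_cancel]; ring
    have e2 : -(((m + 1 : ℕ) : ℂ) * (t * a)) + t * μ * -(((m + 1 : ℕ) : ℂ) * (t * a))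
        = -(((m + 1 : ℕ) : ℂ) * (t * a * (1 + t * μ))) := by ring
    rw [e1, e2, norm_neg, norm_mul, hm, norm_mul, norm_mul, norm_pow, hm, norm_mul]
    ring
  have hlim (f : ℝ → ℝ) (hf : Continuous f) :
      Filter.Tendsto f (nhdsWithin 1 (Set.Iio 1)) (nhds (f 1)) :=
    (hf.tendsto 1).mono_left nhdsWithin_le_nhds
  have h := le_of_tendsto_of_tendsto (hlim _ ?_) (hlim _ ?_)
    (Filter.eventually_of_mem (Ioo_mem_nhdsLT one_pos) hstrict)
  · norm_num at h
    exact h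
  · unfold smirnov
    fun_prop
  · fun_prop

theorem norm_ofReal_add_le_of_le {x y : ℝ} {w : ℂ} (hxy : x ≤ y) (h : 0 ≤ x + w.re) :
    ‖(x : ℂ) + w‖ ≤ ‖(y : ℂ) + w‖ := by
  refine le_of_sq_le_sq ?_ (norm_nonneg _)
  simp only [Complex.sq_norm, Complex.normSq_apply, Complex.add_re, Complex.add_im,
    Complex.ofReal_re, Complex.ofReal_im]
  nlinarith

theorem norm_add_add_mul_norm_add_le {b q s k : ℝ} {μ : ℂ} (hb0 : 0 ≤ b) (hb1 : b ≤ 1)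
    (hq : 1 ≤ q) (hqb : q * b ≤ 1) (hqb2 : 2 ≤ q + b) (hs : 0 ≤ s) (hμ : ‖μ‖ = 1)
    (hk : ‖μ + s * (b + μ)‖ ≤ k) :
    ‖q + μ‖ + s * ‖b + μ‖ ≤ ‖((2 * k - 1) * q : ℝ) + (μ + s * (b + μ))‖ := by
  have hcv : μ.re * μ.re + μ.im * μ.im = 1 := by
    rw [← Complex.normSq_apply, Complex.normSq_eq_norm_sq, hμ, one_pow]
  have hk2 : 1 + s * (1 + b * μ.re) ≤ k := by
    refine le_trans (le_of_eq ?_) ((Complex.re_le_norm ((μ + s * (b + μ)) * conj μ)).trans ?_)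
    · simp only [Complex.add_re, Complex.add_im, Complex.mul_re, Complex.mul_im,
        Complex.ofReal_re, Complex.ofReal_im, Complex.conj_re, Complex.conj_im]
      linear_combination (-(1 + s)) * hcv
    · rwa [norm_mul, Complex.norm_conj, hμ, mul_one]
  have hA : ‖(q : ℂ) + μ‖ ^ 2 = q ^ 2 + 2 * q * μ.re + 1 := by
    simp only [Complex.sq_norm, Complex.normSq_apply, Complex.add_re, Complex.add_im,
      Complex.ofReal_re, Complex.ofReal_im]
    linear_combination hcv
  have hB : ‖(b : ℂ) + μ‖ ^ 2 = b ^ 2 + 2 * b * μ.re + 1 := by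
    simp only [Complex.sq_norm, Complex.normSq_apply, Complex.add_re, Complex.add_im,
      Complex.ofReal_re, Complex.ofReal_im]
    linear_combination hcv
  have hC : ‖((2 * k - 1) * q : ℝ) + (μ + s * (b + μ))‖ ^ 2
      = ((2 * k - 1) * q + μ.re + s * (b + μ.re)) ^ 2 + (1 + s) ^ 2 * (1 - μ.re ^ 2) := by
    simp only [Complex.sq_norm, Complex.normSq_apply, Complex.add_re, Complex.add_im,
      Complex.mul_re, Complex.mul_im, Complex.ofReal_re, Complex.ofReal_im]
    linear_combination (1 + s) ^ 2 * hcv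
  have hc1 : -1 ≤ μ.re := by nlinarith [mul_self_nonneg μ.im]
  refine le_of_sq_le_sq ?_ (norm_nonneg _)
  rw [hC]
  generalize μ.re = c at *
  generalize ‖(q : ℂ) + μ‖ = A at *
  generalize ‖(b : ℂ) + μ‖ = B at *
  have h1 : (q - b) ^ 2 ≤ 4 * q * ((1 - b) * (q - 1)) := by
    have hx : 0 ≤ q - 1 := by linarith
    have hy : 0 ≤ 1 - b := by linarith
    have hd0 : 0 ≤ q + b - 2 := by linarith
    have hd1 : q + b - 2 ≤ (q - 1) * (1 - b) := by linarith
    have h : (q + b - 2) ^ 2 ≤ ((q - 1) * (1 - b)) ^ 2 := by gcongr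
    nlinarith [mul_nonneg (mul_nonneg hx hx) hy, mul_nonneg (mul_nonneg (mul_nonneg hx hx) hy) hb0]
  have h2 : (1 - b) * (q - 1) ≤ (1 + b * c) * (q + c) := by
    have : 1 - b ≤ 1 + b * c := by nlinarith
    exact mul_le_mul this (by linarith) (by linarith) (by nlinarith)
  have h3 : 0 ≤ (b + c) + q * (1 + b * c) := by nlinarith [mul_nonneg hb0 (by linarith : 0 ≤ 1 + c)]
  have hbc : 0 ≤ 1 + b * c := by nlinarith
  have h4 : q + c ≤ q + c + s * (b + c) + (k - 1) * q := by
    nlinarith [mul_nonneg hs h3]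
  have h5 : s * (1 + b * c) * (q + c) ≤ (k - 1) * (q + c + s * (b + c) + (k - 1) * q) :=
    mul_le_mul (by linarith) h4 (by linarith) (by nlinarith [mul_nonneg hs hbc])
  have h6 : (q - b) ^ 2 ≤ 4 * q * ((1 + b * c) * (q + c)) :=
    h1.trans (mul_le_mul_of_nonneg_left h2 (by linarith))
  have h7 : 4 * q * (s * (1 + b * c) * (q + c))
      ≤ 4 * q * ((k - 1) * (q + c + s * (b + c) + (k - 1) * q)) :=
    mul_le_mul_of_nonneg_left h5 (by linarith)
  have h8 : 0 ≤ s * (4 * q * ((1 + b * c) * (q + c)) - (q - b) ^ 2) :=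
    mul_nonneg hs (sub_nonneg.2 h6)
  have h9 : 0 ≤ s * (A - B) ^ 2 := mul_nonneg hs (sq_nonneg _)
  have e : ((2 * k - 1) * q + c + s * (b + c)) ^ 2 + (1 + s) ^ 2 * (1 - c ^ 2) - (A + s * B) ^ 2
      = s * (A - B) ^ 2 - s * (q - b) ^ 2
        + 4 * q * ((k - 1) * (q + c + s * (b + c) + (k - 1) * q)) := by
    linear_combination (-(1 + s)) * hA + (-(s + s ^ 2)) * hB
  linarith

theorem exists_norm_le_one_and_norm_add_add_norm_sub_le {b q k : ℝ} {w : ℂ} (hb0 : 0 ≤ b)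
    (hb1 : b ≤ 1) (hq : 1 ≤ q) (hqb : q * b ≤ 1) (hqb2 : 2 ≤ q + b) (hk : 1 ≤ k) (hw : ‖w‖ ≤ k) :
    ∃ μ : ℂ, ‖μ‖ ≤ 1 ∧ ‖b + μ‖ + ‖w - μ‖ = ‖b + w‖ ∧
      ‖q + μ‖ + ‖w - μ‖ ≤ ‖((2 * k - 1) * q : ℝ) + w‖ := by
  have hqk : q ≤ (2 * k - 1) * q := by nlinarith
  obtain hw1 | hw1 := le_or_gt ‖w‖ 1
  · refine ⟨w, hw1, by simp, ?_⟩
    rw [sub_self, norm_zero, add_zero]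
    refine norm_ofReal_add_le_of_le hqk ?_
    have := (abs_le.1 (Complex.abs_re_le_norm w)).1
    linarith
  obtain ⟨τ, ⟨hτ0, hτ1⟩, hτ⟩ : (1 : ℝ) ∈ (fun τ : ℝ => ‖-(b : ℂ) + τ * (w + b)‖) '' Set.Icc 0 1 := by
    refine intermediate_value_Icc zero_le_one (by fun_prop) ⟨?_, ?_⟩
    · simpa [abs_of_nonneg hb0] using hb1
    · simpa using hw1.le
  simp only at hτ
  set μ := -(b : ℂ) + τ * (w + b) with hμ
  have e1 : b + μ = τ * (b + w) := by rw [hμ]; ring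
  have e2 : w - μ = (1 - τ : ℝ) * (b + w) := by rw [hμ]; push_cast; ring
  have n2 : ‖w - μ‖ = (1 - τ) * ‖b + w‖ := by
    rw [e2, norm_mul, Complex.norm_real, Real.norm_eq_abs, abs_of_nonneg (by linarith)]
  have n1 : ‖b + μ‖ = τ * ‖b + w‖ := by
    rw [e1, norm_mul, Complex.norm_real, Real.norm_eq_abs, abs_of_nonneg hτ0]
  refine ⟨μ, hτ.le, by rw [n1, n2]; ring, ?_⟩
  obtain rfl | hτpos := hτ0.eq_or_lt
  · have hb : b = 1 := by simpa [hμ, abs_of_nonneg hb0] using hτ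
    subst hb
    have hq1 : q = 1 := by linarith
    subst hq1
    rw [n1, n2, zero_mul, zero_add, sub_zero, one_mul]
    obtain h | h := le_or_gt 0 (1 + w.re)
    · exact norm_ofReal_add_le_of_le hqk h
    · refine le_of_sq_le_sq ?_ (norm_nonneg _)
      have := (abs_le.1 (Complex.abs_re_le_norm w)).1
      simp only [Complex.sq_norm, Complex.normSq_apply, Complex.add_re, Complex.add_im,
        Complex.ofReal_re, Complex.ofReal_im]
      nlinarith
  · have hs : w - μ = ((1 - τ) / τ : ℝ) * (b + μ) := by
      have : (τ : ℂ) ≠ 0 := by exact_mod_cast hτpos.ne'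
      rw [e1, e2]; push_cast; field_simp
    have hs0 : 0 ≤ (1 - τ) / τ := div_nonneg (by linarith) hτ0
    have hw' : w = μ + ((1 - τ) / τ : ℝ) * (b + μ) := by rw [← hs]; ring
    have h := norm_add_add_mul_norm_add_le hb0 hb1 hq hqb hqb2 hs0 hτ (hw' ▸ hw)
    rw [← hw'] at h
    rwa [hs, norm_mul, Complex.norm_real, Real.norm_eq_abs, abs_of_nonneg hs0]

theorem exists_norm_le_one_and_norm_pow_add_le {R : ℝ} (hR : 1 ≤ R) (m : ℕ) {w : ℂ}
    (hw : ‖w‖ ≤ (R + 1) / 2) :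
    ∃ μ : ℂ, ‖μ‖ ≤ 1 ∧
      ‖1 + μ * (((R + 1) / 2) ^ m : ℝ)‖ + ((R + 1) / 2) ^ m * ‖w - μ‖
        = ‖1 + w * (((R + 1) / 2) ^ m : ℝ)‖ ∧
      ‖(R : ℂ) ^ m + μ * (((R + 1) / 2) ^ m : ℝ)‖ + ((R + 1) / 2) ^ m * ‖w - μ‖
        ≤ ‖(R : ℂ) ^ (m + 1) + w * (((R + 1) / 2) ^ m : ℝ)‖ := by
  set k := (R + 1) / 2 with hk
  have hk1 : 1 ≤ k := by linarith
  have hk0 : 0 < k := by linarith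
  have hRk : R = 2 * k - 1 := by linarith
  have hkm : 0 < k ^ m := pow_pos hk0 m
  have hinv : k⁻¹ ≤ 1 := inv_le_one_of_one_le₀ hk1
  have hinv0 : 0 < k⁻¹ := inv_pos.2 hk0
  have hRdiv : R / k = 1 + (1 - k⁻¹) := by rw [hRk]; field_simp; ring
  have hqb : (R / k) ^ m * k⁻¹ ^ m ≤ 1 := by
    rw [← mul_pow]
    refine pow_le_one₀ (mul_nonneg (by positivity) hinv0.le) ?_
    rw [hRdiv]
    nlinarith [sq_nonneg (1 - k⁻¹)]
  have hqb2 : 2 ≤ (R / k) ^ m + k⁻¹ ^ m := by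
    have i1 := one_add_mul_le_pow (a := 1 - k⁻¹) (by linarith) m
    have i2 := one_add_mul_le_pow (a := k⁻¹ - 1) (by linarith) m
    rw [add_sub_cancel] at i2
    rw [hRdiv]
    linarith
  obtain ⟨μ, hμ, h1, h2⟩ := exists_norm_le_one_and_norm_add_add_norm_sub_le
    (pow_nonneg hinv0.le m) (pow_le_one₀ hinv0.le hinv) (one_le_pow₀ (by linarith)) hqb hqb2 hk1 hw
  have hscale (x : ℝ) (y : ℂ) : ‖((k ^ m * x : ℝ) : ℂ) + y * (k ^ m : ℝ)‖
      = k ^ m * ‖(x : ℂ) + y‖ := by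
      have hfactor : ((k ^ m * x : ℝ) : ℂ) + y * (k ^ m : ℝ) = (k ^ m : ℝ) * (x + y) := by
        push_cast; ring
      rw [hfactor, norm_mul, Complex.norm_real, Real.norm_eq_abs, abs_of_pos hkm]
  have eb : k ^ m * k⁻¹ ^ m = 1 := by rw [← mul_pow, mul_inv_cancel₀ hk0.ne', one_pow]
  have eq : k ^ m * (R / k) ^ m = R ^ m := by rw [← mul_pow, mul_div_cancel₀ _ hk0.ne']
  have eR : k ^ m * ((2 * k - 1) * (R / k) ^ m) = R ^ (m + 1) := by
    rw [← hRk, mul_left_comm, eq, pow_succ']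
  refine ⟨μ, hμ, ?_, ?_⟩
  · have e1 := hscale (k⁻¹ ^ m) μ
    have e2 := hscale (k⁻¹ ^ m) w
    rw [eb, Complex.ofReal_one] at e1 e2
    rw [e1, e2, ← h1]
    ring
  · have e1 := hscale ((R / k) ^ m) μ
    have e2 := hscale ((2 * k - 1) * (R / k) ^ m) w
    rw [eq, Complex.ofReal_pow] at e1
    rw [eR, Complex.ofReal_pow] at e2
    rw [e1, e2, ← mul_add]
    exact mul_le_mul_of_nonneg_left h2 hkm.le

theorem statement6 (n : ℕ) (P : Polynomial ℂ) (hP : P.natDegree = n)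
    (hP0 : ∀ w : ℂ, ‖w‖ < 1 → P.eval w ≠ 0)
    (a β : ℂ) (ha : ‖a‖ ≤ 1) (hβ : ‖β‖ ≤ 1)
    (R : ℝ) (hR : 1 ≤ R) (z : ℂ) (hz : 1 ≤ ‖z‖) :
    ‖smirnov n a P ((R : ℂ) * z) + β * ((((R + 1) / 2) ^ n : ℝ) : ℂ) * smirnov n a P z‖
      ≤ (1 / 2) * (‖(R : ℂ) ^ n + β * ((((R + 1) / 2) ^ n : ℝ) : ℂ)‖
            * ((n : ℝ) * ‖z‖ ^ (n - 1))
          + ‖1 + β * ((((R + 1) / 2) ^ n : ℝ) : ℂ)‖ * ((n : ℝ) * ‖a‖))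
        * maxCircle P := by
  cases n with
  | zero =>
    rw [eq_C_of_natDegree_eq_zero hP]
    simp [smirnov]
  | succ m =>
    have hM : 0 ≤ maxCircle P :=
      (norm_nonneg _).trans (norm_eval_le_maxCircle P (w := 0) (by simp))
    have hk : (1 : ℝ) ≤ (R + 1) / 2 := by linarith
    have hw : ‖((R + 1) / 2 : ℝ) * β‖ ≤ (R + 1) / 2 := by
      rw [norm_mul, Complex.norm_real, Real.norm_eq_abs, abs_of_nonneg (by linarith)]
      exact mul_le_of_le_one_right (by linarith) hβ
    obtain ⟨μ, hμ, h1, h2⟩ := exists_norm_le_one_and_norm_pow_add_le hR m hw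
    have hβw : β * ((((R + 1) / 2) ^ (m + 1) : ℝ) : ℂ)
        = ((R + 1) / 2 : ℝ) * β * (((R + 1) / 2) ^ m : ℝ) := by
      push_cast; ring
    rw [hβw, Nat.add_sub_cancel, ← h1]
    set k := (R + 1) / 2
    set w := (k : ℂ) * β
    have hkm : 0 ≤ k ^ m := by positivity
    have hnkm : ‖((k ^ m : ℝ) : ℂ)‖ = k ^ m := by
      rw [Complex.norm_real, Real.norm_eq_abs, abs_of_nonneg hkm]
    have hU := two_mul_norm_smirnov_add_le hP hP0 ha hR (μ := μ * (k ^ m : ℝ))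
      (by rw [norm_mul, hnkm]; exact mul_le_of_le_one_left hkm hμ) hz
    have hV := two_mul_norm_smirnov_add_le hP hP0 ha le_rfl (μ := 0) (by simp) hz
    simp only [Complex.ofReal_one, one_mul, zero_mul, add_zero, one_pow, norm_one, mul_one] at hV
    have htri : ‖smirnov (m + 1) a P (R * z) + w * (k ^ m : ℝ) * smirnov (m + 1) a P z‖
        ≤ ‖smirnov (m + 1) a P (R * z) + μ * (k ^ m : ℝ) * smirnov (m + 1) a P z‖
          + k ^ m * ‖w - μ‖ * ‖smirnov (m + 1) a P z‖ := by
      have hsplit : smirnov (m + 1) a P (R * z) + w * (k ^ m : ℝ) * smirnov (m + 1) a P z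
          = smirnov (m + 1) a P (R * z) + μ * (k ^ m : ℝ) * smirnov (m + 1) a P z
            + (k ^ m : ℝ) * (w - μ) * smirnov (m + 1) a P z := by ring
      rw [hsplit]
      refine (norm_add_le _ _).trans_eq ?_
      rw [norm_mul (_ * (w - μ)), norm_mul _ (w - μ), hnkm]
    have hV' := mul_le_mul_of_nonneg_left hV (mul_nonneg hkm (norm_nonneg (w - μ)))
    have h2' := mul_le_mul_of_nonneg_left h2
      (by positivity : 0 ≤ (m + 1) * ‖z‖ ^ m * maxCircle P)
    push_cast at *
    linarith
end

section
/- Let P be a polynomial with complex coefficients of degree n having all its zeros in the disk {z : |z| ≤ k}, where 0 < k ≤ 1. Then for every real R ≥ 1 and every complex z with |z| = 1, |P(Rz)| ≥ ((R+k)/(1+k))^n · |P(z)|. -/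
open Polynomial

/-- The factor inequality for a single zero `w` of modulus at most `k`. -/
theorem norm_sub_le_norm_mul_sub {k R : ℝ} (hk0 : 0 < k) (hk1 : k ≤ 1) (hR : 1 ≤ R)
    {z w : ℂ} (hz : ‖z‖ = 1) (hw : ‖w‖ ≤ k) :
    (R + k) / (1 + k) * ‖z - w‖ ≤ ‖(R : ℂ) * z - w‖ := by
  have hr : 0 ≤ ‖w‖ := norm_nonneg w
  have ha : -‖w‖ ≤ inner ℝ z w := by
    have h := abs_real_inner_le_norm z w
    rw [hz, one_mul] at h
    exact (abs_le.mp h).1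
  have h₁ : ‖z - w‖ ^ 2 = 1 - 2 * inner ℝ z w + ‖w‖ ^ 2 := by
    rw [norm_sub_sq_real, hz, one_pow]
  have h₂ : ‖(R : ℂ) * z - w‖ ^ 2 = R ^ 2 - 2 * (R * inner ℝ z w) + ‖w‖ ^ 2 := by
    rw [← Complex.real_smul, norm_sub_sq_real, real_inner_smul_left, norm_smul, hz, mul_one,
      Real.norm_eq_abs, sq_abs]
  have hfac : (R + k) * (1 + ‖w‖) ≤ (1 + k) * (R + ‖w‖) := by
    nlinarith [mul_nonneg (sub_nonneg.2 hR) (sub_nonneg.2 hw)]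
  have hsq : ((R + k) * (1 + ‖w‖)) ^ 2 ≤ ((1 + k) * (R + ‖w‖)) ^ 2 :=
    pow_le_pow_left₀ (by positivity) hfac 2
  have hkR : 0 ≤ R - k ^ 2 := by nlinarith
  have hinner : 0 ≤ (inner ℝ z w + ‖w‖) * ((R - 1) * (R - k ^ 2)) :=
    mul_nonneg (by linarith) (mul_nonneg (by linarith) hkR)
  rw [div_mul_eq_mul_div, div_le_iff₀ (by linarith)]
  refine le_of_sq_le_sq ?_ (by positivity)
  rw [mul_pow, mul_pow, h₁, h₂]
  linarith

theorem pow_card_mul_norm_prod_sub_le {k R : ℝ} (hk0 : 0 < k) (hk1 : k ≤ 1) (hR : 1 ≤ R)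
    {z : ℂ} (hz : ‖z‖ = 1) (s : Multiset ℂ) (hs : ∀ w ∈ s, ‖w‖ ≤ k) :
    ((R + k) / (1 + k)) ^ s.card * ‖(s.map (z - ·)).prod‖
      ≤ ‖(s.map ((R : ℂ) * z - ·)).prod‖ := by
  induction s using Multiset.induction_on with
  | empty => simp
  | cons w s ih =>
    have h := norm_sub_le_norm_mul_sub hk0 hk1 hR hz (hs w (Multiset.mem_cons_self w s))
    have ih := ih fun v hv => hs v (Multiset.mem_cons_of_mem hv)
    rw [Multiset.card_cons, Multiset.map_cons, Multiset.map_cons, Multiset.prod_cons,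
      Multiset.prod_cons, norm_mul, norm_mul, pow_succ', mul_mul_mul_comm]
    exact mul_le_mul h ih (by positivity) (norm_nonneg _)

theorem statement10 (n : ℕ) (P : Polynomial ℂ) (hP : P.natDegree = n)
    (k : ℝ) (hk0 : 0 < k) (hk1 : k ≤ 1)
    (hPz : ∀ w : ℂ, P.eval w = 0 → ‖w‖ ≤ k)
    (R : ℝ) (hR : 1 ≤ R) (z : ℂ) (hz : ‖z‖ = 1) :
    ((R + k) / (1 + k)) ^ n * ‖P.eval z‖ ≤ ‖P.eval ((R : ℂ) * z)‖ := by
  have hsplit := IsAlgClosed.splits P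
  have hroots : ∀ w ∈ P.roots, ‖w‖ ≤ k := fun w hw => hPz w (isRoot_of_mem_roots hw)
  have h := pow_card_mul_norm_prod_sub_le hk0 hk1 hR hz P.roots hroots
  rw [← hsplit.natDegree_eq_card_roots, hP] at h
  rw [hsplit.eval_eq_prod_roots, hsplit.eval_eq_prod_roots, norm_mul, norm_mul, mul_left_comm]
  exact mul_le_mul_of_nonneg_left h (norm_nonneg _)
end

section
/- Let F be a polynomial with complex coefficients of degree n having all its zeros in the closed unit disk {z : |z| ≤ 1}, and let P be a polynomial with complex coefficients of degree at most n such that |P(z)| ≤ |F(z)| for all z with |z| = 1. Then for every complex z with |z| ≥ 1, |P′(z)| ≤ |F′(z)|. -/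
open Polynomial

theorem le_of_forall_one_lt_of_continuous {f g : ℝ → ℝ} (hf : Continuous f) (hg : Continuous g)
    (h : ∀ R, 1 < R → f R ≤ g R) : f 1 ≤ g 1 := by
  have hcl : (1 : ℝ) ∈ closure (Set.Ioi 1) := by simp
  exact closure_minimal (s := Set.Ioi (1 : ℝ)) (t := {R | f R ≤ g R}) h (isClosed_le hf hg) hcl

namespace Polynomial

theorem norm_eval_eq_norm_eval_reflect_mul_pow {n : ℕ} {P : ℂ[X]} (hP : P.natDegree ≤ n) {w : ℂ}
    (hw : w ≠ 0) : ‖P.eval w‖ = ‖(reflect n P).eval w⁻¹‖ * ‖w‖ ^ n := by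
  have := invertibleOfNonzero hw
  have h := eval₂_reflect_mul_pow (RingHom.id ℂ) w n P hP
  rw [invOf_eq_inv] at h
  rw [eval, ← h, norm_mul, norm_pow, eval]

theorem norm_sub_le_norm_mul_sub {u ζ : ℂ} (hu : ‖u‖ = 1) (hζ : ‖ζ‖ ≤ 1) {R : ℝ} (hR : 1 ≤ R) :
    ‖u - ζ‖ ≤ ‖(R : ℂ) * u - ζ‖ := by
  have hu2 : u.re ^ 2 + u.im ^ 2 = 1 := by
    have := Complex.sq_norm u
    rw [hu, Complex.normSq_apply] at this
    linarith
  have hζ2 : ζ.re ^ 2 + ζ.im ^ 2 ≤ 1 := by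
    have := Complex.sq_norm ζ
    rw [Complex.normSq_apply] at this
    nlinarith [norm_nonneg ζ]
  rw [← sq_le_sq₀ (norm_nonneg _) (norm_nonneg _), Complex.sq_norm, Complex.sq_norm,
    Complex.normSq_apply, Complex.normSq_apply]
  simp only [Complex.sub_re, Complex.sub_im, Complex.re_ofReal_mul, Complex.im_ofReal_mul]
  have hinner : u.re * ζ.re + u.im * ζ.im ≤ 1 := by
    nlinarith [sq_nonneg (u.re - ζ.re), sq_nonneg (u.im - ζ.im)]
  nlinarith [mul_nonneg (sub_nonneg.2 hR) (sub_nonneg.2 hinner),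
    mul_nonneg (sub_nonneg.2 hR) (sub_nonneg.2 hR)]

theorem norm_eval_le_norm_eval_mul {F : ℂ[X]} (hF : ∀ w, F.eval w = 0 → ‖w‖ ≤ 1) {u : ℂ}
    (hu : ‖u‖ = 1) {R : ℝ} (hR : 1 ≤ R) : ‖F.eval u‖ ≤ ‖F.eval (R * u)‖ := by
  have h (x : ℂ) : ‖F.eval x‖ = ‖F.leadingCoeff‖ * (F.roots.map fun a ↦ ‖x - a‖).prod := by
    rw [(IsAlgClosed.splits F).eval_eq_prod_roots, norm_mul]
    congr 1
    simpa [Multiset.map_map, Function.comp_def] using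
      map_multiset_prod (normHom : ℂ →*₀ ℝ) (F.roots.map fun a ↦ x - a)
  rw [h, h]
  refine mul_le_mul_of_nonneg_left (Multiset.prod_map_le_prod_map₀ _ _ (fun _ _ ↦ norm_nonneg _)
    fun a ha ↦ norm_sub_le_norm_mul_sub hu (hF a ?_) hR) (norm_nonneg _)
  exact isRoot_of_mem_roots ha

/-- If all the zeros of `F` lie in the open unit disk, domination of `P` by `F` on the unit circle
extends to domination of the reflected polynomials on the closed unit disk. -/
theorem norm_eval_reflect_le {n : ℕ} {F P : ℂ[X]} (hF : F.natDegree = n)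
    (hF0 : ∀ w, F.eval w = 0 → ‖w‖ < 1) (hP : P.natDegree ≤ n)
    (hPF : ∀ w : ℂ, ‖w‖ = 1 → ‖P.eval w‖ ≤ ‖F.eval w‖) {w : ℂ} (hw : ‖w‖ ≤ 1) :
    ‖(reflect n P).eval w‖ ≤ ‖(reflect n F).eval w‖ := by
  have hne : F ≠ 0 := by
    rintro rfl
    simpa using hF0 1 (by simp)
  have hrefl (v : ℂ) (hv : ‖v‖ ≤ 1) : (reflect n F).eval v ≠ 0 := by
    intro h0
    by_cases hv0 : v = 0
    · rw [hv0, ← coeff_zero_eq_eval_zero, coeff_reflect, revAt_zero, ← hF] at h0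
      exact hne (leadingCoeff_eq_zero.1 h0)
    · have h := norm_eval_eq_norm_eval_reflect_mul_pow hF.le (inv_ne_zero hv0)
      rw [inv_inv, h0, norm_zero, zero_mul, norm_eq_zero] at h
      have := hF0 _ h
      rw [norm_inv] at this
      exact this.not_ge ((one_le_inv₀ (norm_pos_iff.2 hv0)).2 hv)
  have hcl : closure (Metric.ball (0 : ℂ) 1) = Metric.closedBall 0 1 :=
    closure_ball 0 one_ne_zero
  have hd : DiffContOnCl ℂ (fun v ↦ (reflect n P).eval v / (reflect n F).eval v)
      (Metric.ball 0 1) := by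
    apply DifferentiableOn.diffContOnCl
    rw [hcl]
    exact (reflect n P).differentiable.differentiableOn.div
      (reflect n F).differentiable.differentiableOn fun v hv ↦ hrefl v (by simpa using hv)
  have key := Complex.norm_le_of_forall_mem_frontier_norm_le Metric.isBounded_ball hd (C := 1)
    (fun v hv ↦ by
      rw [frontier_ball 0 one_ne_zero, mem_sphere_zero_iff_norm] at hv
      have hv0 : v ≠ 0 := by
        rintro rfl
        simp at hv
      have h := hPF v⁻¹ (by simp [hv])
      rw [norm_eval_eq_norm_eval_reflect_mul_pow hP (inv_ne_zero hv0),
        norm_eval_eq_norm_eval_reflect_mul_pow hF.le (inv_ne_zero hv0)] at h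
      rw [norm_div, div_le_one (norm_pos_iff.2 (hrefl v hv.le))]
      simpa [hv] using h) (z := w) (by rw [hcl]; simpa using hw)
  rwa [norm_div, div_le_one (norm_pos_iff.2 (hrefl w hw))] at key

section Dominated

variable {n : ℕ} {F P : ℂ[X]} (hF : F.natDegree = n) (hF0 : ∀ w, F.eval w = 0 → ‖w‖ ≤ 1)
  (hP : P.natDegree ≤ n) (hPF : ∀ w : ℂ, ‖w‖ = 1 → ‖P.eval w‖ ≤ ‖F.eval w‖)

include hF hF0 hP hPF

theorem norm_eval_reflect_le_reflect_comp {R : ℝ} (hR : 1 < R) {w : ℂ} (hw : ‖w‖ ≤ 1) :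
    ‖(reflect n P).eval w‖ ≤ ‖(reflect n (F.comp (C (R : ℂ) * X))).eval w‖ := by
  have hR0 : (R : ℂ) ≠ 0 := by exact_mod_cast (one_pos.trans hR).ne'
  refine norm_eval_reflect_le ?_ (fun v hv ↦ ?_) hP (fun v hv ↦ ?_) hw
  · rw [natDegree_comp, natDegree_C_mul_X _ hR0, mul_one, hF]
  · have h := hF0 (R * v) (by simpa using hv)
    rw [norm_mul, Complex.norm_of_nonneg (one_pos.trans hR).le] at h
    nlinarith [norm_nonneg v]
  · simpa using (hPF v hv).trans (norm_eval_le_norm_eval_mul hF0 hv hR.le)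

theorem norm_coeff_le_norm_coeff : ‖P.coeff n‖ ≤ ‖F.coeff n‖ := by
  have h := le_of_forall_one_lt_of_continuous (f := fun _ ↦ ‖P.coeff n‖)
    (g := fun R : ℝ ↦ ‖F.coeff n * (R : ℂ) ^ n‖) (by fun_prop) (by fun_prop) fun R hR ↦ by
      have h := norm_eval_reflect_le_reflect_comp hF hF0 hP hPF hR (w := 0) (by simp)
      simpa only [← coeff_zero_eq_eval_zero, coeff_reflect, revAt_zero,
        comp_C_mul_X_coeff] using h
  simpa using h

theorem norm_eval_le_norm_eval_of_one_le {z : ℂ} (hz : 1 ≤ ‖z‖) : ‖P.eval z‖ ≤ ‖F.eval z‖ := by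
  have hz0 : z ≠ 0 := norm_pos_iff.1 (one_pos.trans_le hz)
  have h := le_of_forall_one_lt_of_continuous (f := fun _ ↦ ‖P.eval z‖)
    (g := fun R : ℝ ↦ ‖F.eval (R * z)‖) (by fun_prop) (by fun_prop) fun R hR ↦ by
      have hw : ‖z⁻¹‖ ≤ 1 := by
        rw [norm_inv]
        exact inv_le_one_of_one_le₀ hz
      have h := norm_eval_reflect_le_reflect_comp hF hF0 hP hPF hR hw
      have hR0 : (R : ℂ) ≠ 0 := by exact_mod_cast (one_pos.trans hR).ne'
      have hdeg : (F.comp (C (R : ℂ) * X)).natDegree ≤ n := by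
        rw [natDegree_comp, natDegree_C_mul_X _ hR0, mul_one, hF]
      have hcomp : F.eval (R * z) = (F.comp (C (R : ℂ) * X)).eval z := by simp
      rw [hcomp, norm_eval_eq_norm_eval_reflect_mul_pow hP hz0,
        norm_eval_eq_norm_eval_reflect_mul_pow hdeg hz0]
      gcongr
  simpa using h

end Dominated

theorem norm_le_one_of_eval_derivative_eq_zero {G : ℂ[X]} (hG : 0 < G.natDegree)
    (hG0 : ∀ w, G.eval w = 0 → ‖w‖ ≤ 1) {z : ℂ} (hz : G.derivative.eval z = 0) : ‖z‖ ≤ 1 := by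
  have hpos := natDegree_pos_iff_degree_pos.1 hG
  have hmem : z ∈ convexHull ℝ (Metric.closedBall (0 : ℂ) 1) := by
    rw [eq_centerMass_of_eval_derivative_eq_zero hpos hz]
    refine Finset.centerMass_mem_convexHull _ (fun w _ ↦ derivRootWeight_nonneg _ _ _)
      (sum_derivRootWeight_pos hpos z) fun w hw ↦ ?_
    simpa using hG0 w (isRoot_of_mem_roots (Multiset.mem_toFinset.1 hw))
  rw [(convex_closedBall (0 : ℂ) 1).convexHull_eq] at hmem
  simpa using hmem

theorem norm_eval_derivative_le_of_one_lt {n : ℕ} {F P : ℂ[X]} (hF : F.natDegree = n)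
    (hF0 : ∀ w, F.eval w = 0 → ‖w‖ ≤ 1) (hP : P.natDegree ≤ n)
    (hPF : ∀ w : ℂ, ‖w‖ = 1 → ‖P.eval w‖ ≤ ‖F.eval w‖) {z : ℂ} (hz : 1 < ‖z‖) :
    ‖P.derivative.eval z‖ ≤ ‖F.derivative.eval z‖ := by
  rcases Nat.eq_zero_or_pos n with rfl | hn
  · rw [derivative_of_natDegree_zero (Nat.le_zero.1 hP)]
    simp
  by_contra! hlt
  have hF' : F.derivative.eval z ≠ 0 := fun h ↦
    hz.not_ge (norm_le_one_of_eval_derivative_eq_zero (hF ▸ hn) hF0 h)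
  set c := P.derivative.eval z / F.derivative.eval z with hc
  have hc1 : 1 < ‖c‖ := by rwa [hc, norm_div, one_lt_div (norm_pos_iff.2 hF')]
  have eq_zero_of_norm_mul_le {a : ℂ} (h : ‖c * a‖ ≤ ‖a‖) : a = 0 := by
    rw [norm_mul] at h
    by_contra ha
    nlinarith [norm_pos_iff.2 ha]
  have hcoeff : (P - C c * F).coeff n ≠ 0 := by
    intro h
    rw [coeff_sub, coeff_C_mul, sub_eq_zero] at h
    have hlead : F.coeff n = 0 :=
      eq_zero_of_norm_mul_le (h ▸ norm_coeff_le_norm_coeff hF hF0 hP hPF)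
    rw [← hF, coeff_natDegree, leadingCoeff_eq_zero] at hlead
    simp [hlead] at hF'
  refine hz.not_ge (norm_le_one_of_eval_derivative_eq_zero (G := P - C c * F)
    (hn.trans_le (le_natDegree_of_ne_zero hcoeff)) (fun w hw ↦ ?_) ?_)
  · by_contra! hw1
    rw [eval_sub, eval_C_mul, sub_eq_zero] at hw
    exact hw1.not_ge (hF0 w (eq_zero_of_norm_mul_le
      (hw ▸ norm_eval_le_norm_eval_of_one_le hF hF0 hP hPF hw1.le)))
  · simp [hc, hF']

end Polynomial

theorem statement15 (n : ℕ) (F P : Polynomial ℂ) (hF : F.natDegree = n)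
    (hFz : ∀ w : ℂ, F.eval w = 0 → ‖w‖ ≤ 1) (hPdeg : P.natDegree ≤ n)
    (hPF : ∀ w : ℂ, ‖w‖ = 1 → ‖P.eval w‖ ≤ ‖F.eval w‖)
    (z : ℂ) (hz : 1 ≤ ‖z‖) :
    ‖P.derivative.eval z‖ ≤ ‖F.derivative.eval z‖ := by
  have h := le_of_forall_one_lt_of_continuous (f := fun R : ℝ ↦ ‖P.derivative.eval (R * z)‖)
    (g := fun R : ℝ ↦ ‖F.derivative.eval (R * z)‖) (by fun_prop) (by fun_prop) fun R hR ↦ by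
      refine norm_eval_derivative_le_of_one_lt hF hFz hPdeg hPF ?_
      rw [norm_mul, Complex.norm_of_nonneg (one_pos.trans hR).le]
      nlinarith
  simpa using h
end
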